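/- arXiv:1408.4153 — 2 statements merged into one kernel-verified Lean document; each statement's English description precedes it below -/
import Mathlib

section
/- Let P(z) = Σ_{m=0}^N p_m z^m have nonnegative real coefficients, exact degree N, p_0 > 0, and suppose every root ζ of P satisfies |arg(ζ)| ∈ (2π/3, π] (strictly inside the left wedge, including the negative real axis). If Var(X) > 144×10^7, then sup_m |Prob(X = m) − (2π·Var(X))^{−1/2}·exp(−(m − E[X])²/(2·Var(X)))| ≤ 180/Var(X)^{3/4}, where the supremum is over all integers m. -/
open Finset Real

/-- `P(1) = Σ pₘ`, the normalizing constant. -/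
noncomputable def Psum (P : Polynomial ℝ) : ℝ := P.eval 1

/-- `E[X] = Σ m pₘ / P(1)`. -/
noncomputable def EX (P : Polynomial ℝ) : ℝ :=
  (∑ m ∈ Finset.range (P.natDegree + 1), (m : ℝ) * P.coeff m) / Psum P

/-- `Var(X) = Σ m² pₘ / P(1) − E[X]²`. -/
noncomputable def VarX (P : Polynomial ℝ) : ℝ :=
  (∑ m ∈ Finset.range (P.natDegree + 1), (m : ℝ) ^ 2 * P.coeff m) / Psum P - (EX P) ^ 2

/-- `Prob(X = m)` for an integer `m`: it is `pₘ / P(1)` for `m ≥ 0` and `0` otherwise. -/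
noncomputable def probX (P : Polynomial ℝ) (m : ℤ) : ℝ :=
  if 0 ≤ m then P.coeff m.toNat / Psum P else 0

noncomputable def phiq (q0 q1 q2 t : ℝ) : ℂ := q0 + q1 * Complex.exp (Complex.I * t) + q2 * Complex.exp (Complex.I * t) ^ 2

lemma taylor3 (x : ℝ) : ‖Complex.exp (Complex.I * x) - 1 - Complex.I * x + (x:ℂ)^2/2‖ ≤ 4 * |x|^3 := by
  rcases le_total |x| 1 with h | h
  · have hn : ‖Complex.I * (x:ℂ)‖ = |x| := by simp
    have := Complex.exp_bound (x := Complex.I * x) (by rw [hn]; exact h) (n := 3) (by norm_num)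
    rw [hn] at this
    simp only [Finset.sum_range_succ, Finset.sum_range_zero] at this
    have e : Complex.exp (Complex.I * x) - 1 - Complex.I * x + (x:ℂ)^2/2 = Complex.exp (Complex.I * x) - (0 + (Complex.I * x)^0 / (Nat.factorial 0 : ℂ) + (Complex.I * x)^1 / (Nat.factorial 1 : ℂ) + (Complex.I * x)^2 / (Nat.factorial 2 : ℂ)) := by
      simp [mul_pow]
      ring
    rw [e]
    refine this.trans ?_
    norm_num [Nat.factorial]
    nlinarith [pow_nonneg (abs_nonneg x) 3]
  · have h1 : ‖Complex.exp (Complex.I * x)‖ = 1 := by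
      rw [mul_comm]; exact Complex.norm_exp_ofReal_mul_I x
    have h2 : ‖Complex.exp (Complex.I * x) - 1 - Complex.I * x + (x:ℂ)^2/2‖ ≤ 1 + 1 + |x| + |x|^2/2 := by
      refine (norm_add_le _ _).trans ?_
      gcongr
      · refine (norm_sub_le _ _).trans ?_
        gcongr
        · refine (norm_sub_le _ _).trans ?_
          rw [h1]; simp
        · simp
      · simp
    have h3 : |x| ≤ |x|^2 := by nlinarith
    have h4 : |x|^2 ≤ |x|^3 := by nlinarith [sq_nonneg |x|]
    nlinarith

lemma exp_quad (y : ℝ) (hy : 0 ≤ y) : |Real.exp (-y) - 1 + y| ≤ y^2/2 := by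
  rw [abs_of_nonneg (by linarith [Real.add_one_le_exp (-y)])]
  have h := Real.quadratic_le_exp_of_nonneg hy
  have : Real.exp (-y) * Real.exp y = 1 := by rw [← Real.exp_add]; simp
  have h2 : Real.exp (-y) * (1 + y + y^2/2) ≤ 1 := by
    exact (mul_le_mul_of_nonneg_left h (Real.exp_pos _).le).trans this.le
  by_contra hc
  push Not at hc
  have : (1 - y + y^2/2) * (1 + y + y^2/2) < 1 := by
    refine lt_of_lt_of_le ?_ h2
    have : 0 < 1 + y + y^2/2 := by positivity
    gcongr
    linarith
  nlinarith [pow_nonneg hy 4]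

lemma phiq_norm (q0 q1 q2 t : ℝ) (h0 : 0 ≤ q0) (h1 : 0 ≤ q1) (h2 : 0 ≤ q2) (hs : q0 + q1 + q2 = 1)
    (hlc : q0 * q2 ≤ q1^2) (ht : |t| ≤ π) :
    ‖phiq q0 q1 q2 t‖ ≤ Real.exp (-((q1 + 4*q2 - (q1+2*q2)^2) * t^2/16)) := by
  have hv : q1 + 4*q2 - (q1+2*q2)^2 = q1*(q0+q2) + 4*q0*q2 := by
    have : q0 = 1 - q1 - q2 := by linarith
    subst this; ring
  rw [hv]
  have key : q0*q2*2 ≤ q1*(q0+q2) := by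
    apply le_of_sq_le_sq _ (by positivity)
    have : (q1*(q0+q2))^2 = q1^2*(q0-q2)^2 + 4*(q0*q2)*q1^2 := by ring
    rw [this]
    have := mul_le_mul_of_nonneg_left hlc (mul_nonneg h0 h2)
    nlinarith [mul_nonneg (sq_nonneg q1) (sq_nonneg (q0-q2))]
  have hn : ‖phiq q0 q1 q2 t‖^2 = 1 - 2 * (q1*(q0+q2)) * (1 - cos t) - 4*(q0*q2)*(1 - (cos t)^2) := by
    have e : Complex.exp (Complex.I * t) = (cos t : ℂ) + (sin t : ℂ) * Complex.I := by
      rw [mul_comm, Complex.exp_mul_I]; simp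
    have e2 : phiq q0 q1 q2 t = ((q0 + q1 * cos t + q2 * ((cos t)^2 - (sin t)^2) : ℝ) : ℂ) + ((q1 * sin t + 2*q2*sin t*cos t : ℝ):ℂ) * Complex.I := by
      unfold phiq; rw [e]; push_cast; ring_nf; simp; ring
    rw [e2, Complex.sq_norm, Complex.normSq_add_mul_I]
    have hsn : sin t^2 = 1 - cos t^2 := by linarith [sin_sq_add_cos_sq t]
    have : q0 = 1 - q1 - q2 := by linarith
    subst this
    have : (1 - q1 - q2 + q1 * cos t + q2 * (cos t ^ 2 - sin t ^ 2)) ^ 2 + (q1 * sin t + 2 * q2 * sin t * cos t) ^ 2 =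
      (1 - q1 - q2 + q1 * cos t + q2 * (cos t ^ 2 - sin t ^ 2)) ^ 2 + sin t^2 * (q1 + 2 * q2 * cos t) ^ 2 := by ring
    rw [this, hsn]; ring
  have hc : cos t ≤ 1 - 3/16 * t^2 := by
    refine (Real.cos_le_one_sub_mul_cos_sq ht).trans ?_
    have : 3/16 ≤ 2/π^2 := by
      rw [le_div_iff₀ (by positivity)]
      nlinarith [Real.pi_lt_d2, Real.pi_gt_three]
    nlinarith [sq_nonneg t]
  have hb : ‖phiq q0 q1 q2 t‖^2 ≤ Real.exp (-((q1*(q0+q2) + 4*q0*q2) * t^2/16))^2 := by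
    rw [← Real.exp_nat_mul]
    refine le_trans ?_ (Real.add_one_le_exp _)
    rw [hn]
    have c1 : 0 ≤ 1 - cos t^2 := by nlinarith [sin_sq_add_cos_sq t, sq_nonneg (sin t)]
    have := mul_nonneg (mul_nonneg h0 h2) c1
    have k2 : (q1*(q0+q2) + 4*q0*q2) ≤ 3 * (q1*(q0+q2)) := by nlinarith
    have k3 := mul_le_mul_of_nonneg_right k2 (sq_nonneg t)
    have k4 : q1*(q0+q2) * (3/16 * t^2) ≤ q1*(q0+q2) * (1 - cos t) := by
      apply mul_le_mul_of_nonneg_left _ (by positivity); linarith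
    push_cast
    nlinarith
  exact le_of_sq_le_sq hb (Real.exp_pos _).le

lemma phiq_taylor (q0 q1 q2 t : ℝ) (h0 : 0 ≤ q0) (h1 : 0 ≤ q1) (h2 : 0 ≤ q2) (hs : q0 + q1 + q2 = 1)
    (ht : |t| ≤ π) :
    ‖phiq q0 q1 q2 t * Complex.exp (-(Complex.I * ((q1+2*q2 : ℝ):ℂ) * t)) - (Real.exp (-((q1 + 4*q2 - (q1+2*q2)^2) * t^2/2)) : ℝ)‖ ≤ 
      27 * (q1 + 4*q2 - (q1+2*q2)^2) * |t|^3 * Real.exp (-((q1 + 4*q2 - (q1+2*q2)^2) * t^2/16)) := by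
  set μ := q1 + 2*q2 with hμ
  set v := q1 + 4*q2 - μ^2 with hv
  have hv0 : v = q1*(q0+q2) + 4*q0*q2 := by
    have : q0 = 1 - q1 - q2 := by linarith
    rw [hv, hμ]
    subst this; ring
  have hvn : 0 ≤ v := by rw [hv0]; positivity
  have hv1 : v ≤ 1 := by
    nlinarith [sq_nonneg (μ-1)]
  have hpi : t^2 ≤ 10 := by
    have := sq_abs t
    nlinarith [Real.pi_lt_d2, abs_nonneg t]
  have hexp : 1/3 ≤ Real.exp (-(v * t^2/16)) := by
    refine le_trans ?_ (Real.add_one_le_exp _)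
    nlinarith [sq_nonneg t]
  have ha : |Real.exp (-(v*t^2/2)) - 1 + v*t^2/2| ≤ v * |t|^3 := by
    refine (exp_quad (v*t^2/2) (by positivity)).trans ?_
    have e : (v*t^2/2)^2/2 = v * |t|^3 * (v * |t| / 8) := by
      have := sq_abs t
      rw [← this]; ring
    rw [e]
    have : v * |t| / 8 ≤ 1 := by nlinarith [Real.pi_lt_d2, abs_nonneg t]
    have : 0 ≤ v * |t|^3 := by positivity
    nlinarith
  set E : ℝ → ℂ := fun x => Complex.exp (Complex.I * x) - 1 - Complex.I * x + (x:ℂ)^2/2 with hE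
  have hdec : phiq q0 q1 q2 t * Complex.exp (-(Complex.I * ((μ : ℝ):ℂ) * t)) - (Real.exp (-(v * t^2/2)) : ℝ)
     = q0 * E ((0-μ)*t) + q1 * E ((1-μ)*t) + q2 * E ((2-μ)*t) - ((Real.exp (-(v*t^2/2)) - 1 + v*t^2/2 : ℝ) : ℂ) := by
    have e0 : Complex.exp (-(Complex.I * ((μ : ℝ):ℂ) * t)) = Complex.exp (Complex.I * (((0-μ)*t : ℝ):ℂ)) := by
      congr 1; push_cast; ring
    have e1 : Complex.exp (Complex.I * t) * Complex.exp (-(Complex.I * ((μ : ℝ):ℂ) * t)) = Complex.exp (Complex.I * (((1-μ)*t : ℝ):ℂ)) := by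
      rw [← Complex.exp_add]; congr 1; push_cast; ring
    have e2 : Complex.exp (Complex.I * t)^2 * Complex.exp (-(Complex.I * ((μ : ℝ):ℂ) * t)) = Complex.exp (Complex.I * (((2-μ)*t : ℝ):ℂ)) := by
      rw [← Complex.exp_nat_mul, ← Complex.exp_add]; congr 1; push_cast; ring
    unfold phiq
    simp only [add_mul, mul_assoc]
    simp only [mul_assoc] at e0 e1 e2
    rw [e1, e2, e0, hE]
    have hs' : (q0:ℂ) = 1 - q1 - q2 := by rw [← Complex.ofReal_one, ← hs]; push_cast; ring
    have hv' : (v:ℂ) = q1 + 4*q2 - (q1+2*q2)^2 := by rw [hv, hμ]; push_cast; ring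
    have hμ' : (μ:ℂ) = q1 + 2*q2 := by rw [hμ]; push_cast; ring
    push_cast
    rw [hv', hs']
    generalize Complex.exp (Complex.I * (((0:ℂ)-μ)*t)) = A
    generalize Complex.exp (Complex.I * (((1:ℂ)-μ)*t)) = B
    generalize Complex.exp (Complex.I * (((2:ℂ)-μ)*t)) = D
    rw [hμ']
    ring
  have hEb : ∀ k : ℝ, |k - μ| ≤ 2 → ‖E ((k-μ)*t)‖ ≤ 8 * (k-μ)^2 * |t|^3 := by
    intro k hk
    refine (taylor3 _).trans ?_
    rw [abs_mul, mul_pow]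
    have : |k-μ|^3 ≤ 2 * (k-μ)^2 := by
      rw [← sq_abs (k-μ)]; nlinarith [sq_nonneg |k-μ|]
    have h3 : 0 ≤ |t|^3 := by positivity
    nlinarith
  have b0 := hEb 0 (by rw [abs_le]; constructor <;> linarith)
  have b1 := hEb 1 (by rw [abs_le]; constructor <;> linarith)
  have b2 := hEb 2 (by rw [abs_le]; constructor <;> linarith)
  have htot : ‖phiq q0 q1 q2 t * Complex.exp (-(Complex.I * ((μ : ℝ):ℂ) * t)) - (Real.exp (-(v * t^2/2)) : ℝ)‖ ≤ 9 * v * |t|^3 := by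
    rw [hdec]
    have nq : ∀ q : ℝ, 0 ≤ q → ∀ z : ℂ, ∀ b : ℝ, ‖z‖ ≤ b → ‖(q:ℂ) * z‖ ≤ q * b := by
      intro q hq z b hb
      rw [norm_mul, Complex.norm_real, Real.norm_of_nonneg hq]
      gcongr
    refine (norm_sub_le _ _).trans ?_
    have := nq q0 h0 _ _ b0
    have := nq q1 h1 _ _ b1
    have := nq q2 h2 _ _ b2
    have : ‖((Real.exp (-(v*t^2/2)) - 1 + v*t^2/2 : ℝ) : ℂ)‖ ≤ v * |t|^3 := by
      rw [Complex.norm_real]; exact ha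
    have := norm_add_le ((q0:ℂ) * E ((0-μ)*t) + q1 * E ((1-μ)*t)) (q2 * E ((2-μ)*t))
    have := norm_add_le ((q0:ℂ) * E ((0-μ)*t)) (q1 * E ((1-μ)*t))
    have hsum : q0 * (8 * (0-μ)^2 * |t|^3) + q1 * (8 * (1-μ)^2 * |t|^3) + q2 * (8 * (2-μ)^2 * |t|^3) = 8 * v * |t|^3 := by
      have : q0 = 1 - q1 - q2 := by linarith
      rw [hv, hμ]
      subst this; ring
    linarith
  refine htot.trans ?_
  have : 0 ≤ v * |t|^3 := by positivity
  nlinarith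

noncomputable def opD (P : Polynomial ℝ) : Polynomial ℝ := Polynomial.X * Polynomial.derivative P
noncomputable def muP (P : Polynomial ℝ) : ℝ := (opD P).eval 1 / P.eval 1
noncomputable def varP (P : Polynomial ℝ) : ℝ := (opD (opD P)).eval 1 / P.eval 1 - (muP P)^2
noncomputable def chi (P : Polynomial ℝ) (t : ℝ) : ℂ :=
  Polynomial.aeval (Complex.exp (Complex.I * t)) P / ((P.eval 1 : ℝ) : ℂ)

structure Good (P : Polynomial ℝ) : Prop where
  pos : 0 < P.eval 1
  var : 0 ≤ varP P
  nrm : ∀ t : ℝ, |t| ≤ π → ‖chi P t‖ ≤ Real.exp (-(varP P * t^2/16))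
  tay : ∀ t : ℝ, |t| ≤ π →
    ‖chi P t * Complex.exp (-(Complex.I * ((muP P : ℝ):ℂ) * t)) - (Real.exp (-(varP P * t^2/2)) : ℝ)‖ ≤ 
      27 * varP P * |t|^3 * Real.exp (-(varP P * t^2/16))

lemma opD_mul (P Q : Polynomial ℝ) : opD (P * Q) = opD P * Q + P * opD Q := by
  unfold opD; rw [Polynomial.derivative_mul]; ring

lemma opD_add (P Q : Polynomial ℝ) : opD (P + Q) = opD P + opD Q := by
  unfold opD; rw [Polynomial.derivative_add]; ring

lemma muP_mul (P Q : Polynomial ℝ) (hP : P.eval 1 ≠ 0) (hQ : Q.eval 1 ≠ 0) :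
    muP (P * Q) = muP P + muP Q := by
  unfold muP
  rw [opD_mul]
  simp only [Polynomial.eval_add, Polynomial.eval_mul]
  field_simp

lemma varP_mul (P Q : Polynomial ℝ) (hP : P.eval 1 ≠ 0) (hQ : Q.eval 1 ≠ 0) :
    varP (P * Q) = varP P + varP Q := by
  unfold varP
  rw [muP_mul P Q hP hQ, opD_mul, opD_add, opD_mul, opD_mul]
  unfold muP
  simp only [Polynomial.eval_add, Polynomial.eval_mul]
  field_simp
  ring

lemma chi_mul (P Q : Polynomial ℝ) (t : ℝ) : chi (P * Q) t = chi P t * chi Q t := by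
  unfold chi
  simp only [map_mul, Polynomial.eval_mul, Complex.ofReal_mul]
  rw [mul_div_mul_comm]

lemma Good.mul {P Q : Polynomial ℝ} (hP : Good P) (hQ : Good Q) : Good (P * Q) := by
  have e1 := muP_mul P Q hP.pos.ne' hQ.pos.ne'
  have e2 := varP_mul P Q hP.pos.ne' hQ.pos.ne'
  have hnm : ∀ t : ℝ, |t| ≤ π → ‖chi (P * Q) t‖ ≤ Real.exp (-(varP (P * Q) * t^2/16)) := by
    intro t ht
    rw [chi_mul, e2, norm_mul]
    have : Real.exp (-((varP P + varP Q) * t^2/16)) = Real.exp (-(varP P * t^2/16)) * Real.exp (-(varP Q * t^2/16)) := by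
      rw [← Real.exp_add]; congr 1; ring
    rw [this]
    exact mul_le_mul (hP.nrm t ht) (hQ.nrm t ht) (norm_nonneg _) (Real.exp_pos _).le
  refine ⟨?_, ?_, hnm, ?_⟩
  · rw [Polynomial.eval_mul]; exact mul_pos hP.pos hQ.pos
  · rw [e2]; exact add_nonneg hP.var hQ.var
  · intro t ht
    rw [e2, e1, chi_mul]
    have x1 : Real.exp (-((varP P + varP Q) * t^2/16)) = Real.exp (-(varP P * t^2/16)) * Real.exp (-(varP Q * t^2/16)) := by
      rw [← Real.exp_add]; congr 1; ring
    have x2 : Real.exp (-((varP P + varP Q) * t^2/2)) = Real.exp (-(varP P * t^2/2)) * Real.exp (-(varP Q * t^2/2)) := by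
      rw [← Real.exp_add]; congr 1; ring
    have x3 : Complex.exp (-(Complex.I * ((muP P + muP Q : ℝ):ℂ) * t)) = Complex.exp (-(Complex.I * ((muP P : ℝ):ℂ) * t)) * Complex.exp (-(Complex.I * ((muP Q : ℝ):ℂ) * t)) := by
      rw [← Complex.exp_add]; congr 1; push_cast; ring
    have u : ‖Complex.exp (-(Complex.I * ((muP Q : ℝ):ℂ) * t))‖ = 1 := by
      rw [show -(Complex.I * ((muP Q : ℝ):ℂ) * t) = ((-(muP Q * t) : ℝ) : ℂ) * Complex.I by push_cast; ring]
      exact Complex.norm_exp_ofReal_mul_I _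
    have p1 := hP.tay t ht
    have p2 := hQ.tay t ht
    have p3 := hQ.nrm t ht
    have p4 : Real.exp (-(varP P * t^2/2)) ≤ Real.exp (-(varP P * t^2/16)) := by
      apply Real.exp_le_exp.2
      have := mul_nonneg hP.var (sq_nonneg t)
      linarith
    rw [x1, x2, x3]
    set a := chi P t * Complex.exp (-(Complex.I * ((muP P : ℝ):ℂ) * t))
    set b := chi Q t * Complex.exp (-(Complex.I * ((muP Q : ℝ):ℂ) * t)) with hb
    have p3' : ‖b‖ ≤ Real.exp (-(varP Q * t^2/16)) := by
      rw [hb, norm_mul, u, mul_one]; exact p3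
    set g := Real.exp (-(varP P * t^2/2))
    set h := Real.exp (-(varP Q * t^2/2))
    have e : chi P t * chi Q t * (Complex.exp (-(Complex.I * ((muP P : ℝ):ℂ) * t)) * Complex.exp (-(Complex.I * ((muP Q : ℝ):ℂ) * t))) - ((g * h : ℝ) : ℂ)
      = (a - (g:ℂ)) * b + (g:ℂ) * (b - (h:ℂ)) := by
      push_cast; ring
    rw [e]
    refine (norm_add_le _ _).trans ?_
    rw [norm_mul (a - (g:ℂ)) b, norm_mul (g:ℂ), Complex.norm_real, Real.norm_of_nonneg (Real.exp_pos _).le]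
    have q1 := mul_le_mul p1 p3' (norm_nonneg _) ((norm_nonneg _).trans p1)
    have q2 := mul_le_mul p4 p2 (norm_nonneg _) (Real.exp_pos _).le
    refine (add_le_add q1 q2).trans (le_of_eq ?_)
    ring

lemma good_quad (a b c : ℝ) (ha : 0 ≤ a) (hb : 0 ≤ b) (hc : 0 ≤ c) (hs : 0 < a + b + c) (hlc : c * a ≤ b^2) :
    Good (Polynomial.C a * Polynomial.X^2 + Polynomial.C b * Polynomial.X + Polynomial.C c) := by
  set P := Polynomial.C a * Polynomial.X^2 + Polynomial.C b * Polynomial.X + Polynomial.C c with hP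
  set s := a + b + c with hsd
  have ev : P.eval 1 = s := by simp [hP, hsd]
  have hmu : muP P = b/s + 2 * (a/s) := by
    unfold muP; rw [ev]; simp [hP, opD]; field_simp; ring
  have hvar : varP P = b/s + 4 * (a/s) - (b/s + 2 * (a/s))^2 := by
    unfold varP; rw [ev, hmu]; simp [hP, opD]; field_simp; ring
  have hchi : ∀ t, chi P t = phiq (c/s) (b/s) (a/s) t := by
    intro t; unfold chi phiq; rw [ev]; simp [hP]; ring
  have g0 : 0 ≤ c/s := by positivity
  have g1 : 0 ≤ b/s := by positivity
  have g2 : 0 ≤ a/s := by positivity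
  have gs : c/s + b/s + a/s = 1 := by
    rw [← add_div, ← add_div, div_eq_one_iff_eq hs.ne', hsd]; ring
  have gl : c/s * (a/s) ≤ (b/s)^2 := by
    rw [div_mul_div_comm, div_pow, ← sq]
    gcongr
  refine ⟨by rw [ev]; exact hs, ?_, ?_, ?_⟩
  · have : varP P = (b/s) * (c/s + a/s) + 4 * (c/s) * (a/s) := by
      rw [hvar]
      have : c/s = 1 - b/s - a/s := by linarith
      rw [this]; ring
    rw [this]; positivity
  · intro t ht
    rw [hchi, hvar]
    exact phiq_norm _ _ _ t g0 g1 g2 gs gl ht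
  · intro t ht
    rw [hchi, hvar, hmu]
    exact phiq_taylor _ _ _ t g0 g1 g2 gs ht

lemma root_re (ζ : ℂ) (h : 2 * π / 3 < |Complex.arg ζ|) : ζ.re < 0 ∧ ‖ζ‖^2 ≤ (2 * ζ.re)^2 := by
  have hz : ζ ≠ 0 := by
    rintro rfl
    simp at h
    linarith [Real.pi_pos]
  have hn : 0 < ‖ζ‖ := norm_pos_iff.2 hz
  have hc : Real.cos (Complex.arg ζ) < -(1/2) := by
    rw [← Real.cos_abs]
    have e : -(1/2) = Real.cos (2*π/3) := by
      rw [show 2*π/3 = π - π/3 by ring, Real.cos_pi_sub, Real.cos_pi_div_three]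
    rw [e]
    exact Real.cos_lt_cos_of_nonneg_of_le_pi (by positivity) (Complex.abs_arg_le_pi ζ) h
  have hr := Complex.norm_mul_cos_arg ζ
  constructor
  · nlinarith
  · rw [← hr]
    have : 1 ≤ (2 * Real.cos (Complex.arg ζ))^2 := by nlinarith
    nlinarith [sq_nonneg ‖ζ‖]

lemma good_all (n : ℕ) : ∀ P : Polynomial ℝ, P.natDegree = n → 0 < P.leadingCoeff →
    (∀ ζ : ℂ, Polynomial.aeval ζ P = 0 → 2 * π / 3 < |Complex.arg ζ|) → Good P := by
  induction n using Nat.strong_induction_on with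
  | _ n ih =>
  intro P hd hl hr
  rcases Nat.eq_zero_or_pos n with h0 | hpos
  · have e := Polynomial.eq_C_of_natDegree_eq_zero (hd.trans h0)
    rw [e] at hl ⊢
    rw [Polynomial.leadingCoeff_C] at hl
    have := good_quad 0 0 (P.coeff 0) le_rfl le_rfl hl.le (by simpa using hl) (by simp)
    simpa using this
  · obtain ⟨ζ, hζ⟩ : ∃ ζ : ℂ, Polynomial.aeval ζ P = 0 := by
      apply Complex.isAlgClosed.exists_aeval_eq_zero ℂ P
      intro h
      rw [Polynomial.natDegree_eq_of_degree_eq_some (n := 0) h] at hd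
      omega
    obtain ⟨hre, hsq⟩ := root_re ζ (hr ζ hζ)
    obtain ⟨Q, hQ, hQm, hQd, R, hR⟩ : ∃ Q : Polynomial ℝ, Good Q ∧ Q.Monic ∧ 0 < Q.natDegree ∧ Q ∣ P := by
      by_cases him : ζ.im = 0
      · refine ⟨Polynomial.X - Polynomial.C ζ.re, ?_, Polynomial.monic_X_sub_C _, by simp, ?_⟩
        · have := good_quad 0 1 (-ζ.re) le_rfl zero_le_one (by linarith) (by linarith) (by simp)
          simpa [sub_eq_add_neg] using this
        · rw [Polynomial.dvd_iff_isRoot]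
          have e : ζ = ((ζ.re : ℝ) : ℂ) := by apply Complex.ext <;> simp [him]
          rw [e] at hζ
          have : Polynomial.aeval ((algebraMap ℝ ℂ) ζ.re) P = 0 := hζ
          rw [Polynomial.aeval_algebraMap_apply] at this
          simpa using this
      · have e : (Polynomial.X ^ 2 - Polynomial.C (2 * ζ.re) * Polynomial.X + Polynomial.C (‖ζ‖ ^ 2) : Polynomial ℝ) = Polynomial.C 1 * Polynomial.X^2 + Polynomial.C (-(2*ζ.re)) * Polynomial.X + Polynomial.C (‖ζ‖^2) := by
          simp [sub_eq_add_neg]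
        refine ⟨_, ?_, ?_, ?_, Polynomial.quadratic_dvd_of_aeval_eq_zero_im_ne_zero P hζ him⟩
        · rw [e]
          refine good_quad _ _ _ zero_le_one (by linarith) (by positivity) ?_ ?_
          · have := sq_nonneg ‖ζ‖
            linarith
          · linarith [neg_sq (2*ζ.re)]
        · rw [e, Polynomial.Monic, Polynomial.leadingCoeff_quadratic one_ne_zero]
        · rw [e, Polynomial.natDegree_quadratic one_ne_zero]; norm_num
    have hR0 : R ≠ 0 := by
      rintro rfl
      rw [mul_zero] at hR
      rw [hR] at hl; simp at hl
    have hnd : P.natDegree = Q.natDegree + R.natDegree := by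
      rw [hR, Polynomial.natDegree_mul hQm.ne_zero hR0]
    have hRg : Good R := by
      refine ih R.natDegree (by omega) R rfl ?_ ?_
      · rw [hR, Polynomial.leadingCoeff_mul, hQm.leadingCoeff, one_mul] at hl
        exact hl
      · intro z hz
        apply hr z
        rw [hR, map_mul, hz, mul_zero]
    rw [hR]
    exact hQ.mul hRg

open MeasureTheory in
lemma int_cube (b : ℝ) (hb : 0 < b) :
    Integrable (fun t : ℝ => |t|^3 * Real.exp (-b * t^2)) ∧
    ∫ t : ℝ, |t|^3 * Real.exp (-b * t^2) = 1 / b^2 := by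
  constructor
  · have h := (integrable_rpow_mul_exp_neg_mul_sq hb (s := 3) (by norm_num)).norm
    refine h.congr (Filter.Eventually.of_forall fun t => ?_)
    simp only [norm_mul, Real.norm_eq_abs, Real.abs_exp]
    congr 1
    rw [← abs_pow]; norm_cast
  · have h := integral_rpow_mul_exp_neg_mul_rpow (p := 2) (q := 3) two_pos (by norm_num) hb
    have h2 := integral_comp_abs (f := fun t : ℝ => t^3 * Real.exp (-b * t^2))
    simp only [sq_abs] at h2
    rw [h2]
    have h3 : ∫ t in Set.Ioi (0:ℝ), t^3 * Real.exp (-b * t^2) = b ^ (-(3 + 1) / 2 : ℝ) * (1 / 2) * Gamma ((3 + 1) / 2) := by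
      rw [← h]
      refine integral_congr_ae (Filter.Eventually.of_forall fun t => ?_)
      norm_cast
    rw [h3, show ((3:ℝ)+1)/2 = 2 by norm_num, show (-(3+1)/2 : ℝ) = -2 by norm_num, Real.Gamma_two, Real.rpow_neg hb.le]
    norm_num
    ring

lemma int_exp (k : ℤ) : ∫ t in (-π)..π, Complex.exp (Complex.I * k * t) = if k = 0 then 2 * (π:ℂ) else 0 := by
  split_ifs with h
  · subst h; simp; ring
  · have hk : Complex.I * (k:ℂ) ≠ 0 := mul_ne_zero Complex.I_ne_zero (by exact_mod_cast h)
    rw [integral_exp_mul_complex hk]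
    rw [div_eq_zero_iff]; left
    rw [sub_eq_zero, Complex.exp_eq_exp_iff_exists_int]
    exact ⟨k, by push_cast; ring⟩

lemma prob_fourier (P : Polynomial ℝ) (m : ℤ) :
    ∫ t in (-π)..π, chi P t * Complex.exp (-(Complex.I * m * t)) = 2 * π * (probX P m : ℂ) := by
  have e : ∀ t : ℝ, chi P t * Complex.exp (-(Complex.I * m * t)) =
      ∑ j ∈ Finset.range (P.natDegree + 1), ((P.coeff j / P.eval 1 : ℝ) : ℂ) * Complex.exp (Complex.I * ((j - m : ℤ) : ℂ) * t) := by
    intro t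
    unfold chi
    rw [Polynomial.aeval_eq_sum_range, Finset.sum_div, Finset.sum_mul]
    refine Finset.sum_congr rfl fun j _ => ?_
    have : Complex.exp (Complex.I * ((j - m : ℤ) : ℂ) * t) = Complex.exp (Complex.I * t)^j * Complex.exp (-(Complex.I * m * t)) := by
      rw [← Complex.exp_nat_mul, ← Complex.exp_add]; congr 1; push_cast; ring
    rw [this, Complex.real_smul]; push_cast; ring
  simp_rw [e]
  rw [intervalIntegral.integral_finsetSum]
  · simp_rw [intervalIntegral.integral_const_mul, int_exp]
    unfold probX Psum
    split_ifs with hm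
    · lift m to ℕ using hm
      simp only [Int.toNat_natCast, sub_eq_zero, Nat.cast_inj]
      by_cases hr : m < P.natDegree + 1
      · rw [Finset.sum_eq_single m]
        · simp; ring
        · intro j _ hj; simp [hj]
        · intro hc; exact absurd (Finset.mem_range.2 hr) hc
      · rw [Polynomial.coeff_eq_zero_of_natDegree_lt (by omega)]
        rw [Finset.sum_eq_zero]
        · simp
        · intro j hj
          have : j ≠ m := by have := Finset.mem_range.1 hj; omega
          simp [this]
    · rw [Finset.sum_eq_zero]
      · simp
      · intro j hj
        have : (j:ℤ) - m ≠ 0 := by omega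
        simp [this]
  · intro j _
    apply Continuous.intervalIntegrable
    fun_prop

lemma opD_eval (P : Polynomial ℝ) (n : ℕ) (h : P.natDegree < n) :
    P.eval 1 = ∑ m ∈ Finset.range n, P.coeff m := by
  rw [Polynomial.eval_eq_sum_range' h]; simp

lemma opD_coeff (P : Polynomial ℝ) (m : ℕ) : (opD P).coeff m = m * P.coeff m := by
  unfold opD
  cases m with
  | zero => simp
  | succ k => rw [Polynomial.coeff_X_mul, Polynomial.coeff_derivative]; push_cast; ring

lemma opD_natDegree (P : Polynomial ℝ) : (opD P).natDegree ≤ P.natDegree := by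
  rw [Polynomial.natDegree_le_iff_coeff_eq_zero]
  intro m hm
  rw [opD_coeff, Polynomial.coeff_eq_zero_of_natDegree_lt hm, mul_zero]

lemma muP_eq (P : Polynomial ℝ) : muP P = EX P := by
  unfold muP EX Psum
  rw [opD_eval (opD P) (P.natDegree + 1) (Nat.lt_succ_of_le (opD_natDegree P))]
  simp_rw [opD_coeff]

lemma varP_eq (P : Polynomial ℝ) : varP P = VarX P := by
  unfold varP VarX Psum
  rw [muP_eq, opD_eval (opD (opD P)) (P.natDegree + 1) (Nat.lt_succ_of_le ((opD_natDegree _).trans (opD_natDegree P)))]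
  simp_rw [opD_coeff, sq, mul_assoc]

open MeasureTheory in
lemma good_final (P : Polynomial ℝ) (hP : Good P) (hV : 1 ≤ VarX P) (m : ℤ) :
    |probX P m - (Real.sqrt (2 * π * VarX P))⁻¹ * Real.exp (-((m : ℝ) - EX P) ^ 2 / (2 * VarX P))|
      ≤ 1800 / VarX P := by
  have hV' := varP_eq P
  have hM' := muP_eq P
  set V := VarX P with hVd
  set μ := EX P with hμ
  have hVp : 0 < V := by linarith
  set f : ℝ → ℂ := (Set.Ioc (-π) π).indicator (fun t => chi P t * Complex.exp (-(Complex.I * m * t))) with hf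
  set g : ℝ → ℂ := fun t => Complex.exp (Complex.I * ((μ - m : ℝ) : ℂ) * t) * Complex.exp (-((V/2 : ℝ):ℂ) * t^2) with hg
  have hcont : Continuous (fun t : ℝ => chi P t * Complex.exp (-(Complex.I * m * t))) := by
    unfold chi
    have : Continuous (fun t : ℝ => Polynomial.aeval (Complex.exp (Complex.I * t)) P) :=
      (Polynomial.continuous_aeval P).comp (by fun_prop)
    fun_prop
  have hfi : Integrable f := by
    rw [hf, integrable_indicator_iff measurableSet_Ioc]
    exact (hcont.integrableOn_Icc).mono_set Set.Ioc_subset_Icc_self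
  have hfint : ∫ t, f t = 2 * π * (probX P m : ℂ) := by
    rw [hf, integral_indicator measurableSet_Ioc, ← intervalIntegral.integral_of_le (by linarith [Real.pi_pos]), prob_fourier]
  have hgi : Integrable g := by
    have := integrable_cexp_quadratic (b := ((V/2 : ℝ):ℂ)) (by rw [Complex.ofReal_re]; positivity) (Complex.I * ((μ - m : ℝ) : ℂ)) 0
    refine this.congr (Filter.Eventually.of_forall fun t => ?_)
    simp only [hg]
    rw [← Complex.exp_add]; congr 1; ring
  have hgint : ∫ t, g t = ((2 * π * ((Real.sqrt (2 * π * V))⁻¹ * Real.exp (-((m : ℝ) - μ) ^ 2 / (2 * V))) : ℝ) : ℂ) := by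
    rw [hg, fourierIntegral_gaussian (by rw [Complex.ofReal_re]; positivity)]
    have e1 : ((π:ℂ) / ((V/2 : ℝ):ℂ)) ^ (1/2 : ℂ) = ((2 * π * (Real.sqrt (2 * π * V))⁻¹ : ℝ) : ℂ) := by
      have : ((π:ℂ) / ((V/2 : ℝ):ℂ)) ^ (1/2 : ℂ) = (((π / (V/2)) ^ (1/2 : ℝ) : ℝ) : ℂ) := by
        rw [Complex.ofReal_cpow (by positivity)]; push_cast; rfl
      rw [this, ← Real.sqrt_eq_rpow]
      congr 1
      rw [Real.sqrt_eq_iff_mul_self_eq (by positivity) (by positivity)]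
      have hs : Real.sqrt (2 * π * V) * Real.sqrt (2 * π * V) = 2 * π * V := Real.mul_self_sqrt (by positivity)
      have : (2 * π * (Real.sqrt (2 * π * V))⁻¹) * (2 * π * (Real.sqrt (2 * π * V))⁻¹) = (2*π)^2 * (Real.sqrt (2 * π * V) * Real.sqrt (2 * π * V))⁻¹ := by
        rw [mul_inv]; ring
      rw [this, hs]
      field_simp
    rw [e1, ← mul_assoc, Complex.ofReal_mul (2 * π * (Real.sqrt (2 * π * V))⁻¹)]
    congr 1
    rw [Complex.ofReal_exp]
    congr 1
    push_cast
    have : (V:ℂ) ≠ 0 := by exact_mod_cast hVp.ne'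
    field_simp
    ring
  have hb : ∀ t, ‖f t - g t‖ ≤ 27 * V * (|t|^3 * Real.exp (-(V/16) * t^2)) := by
    intro t
    have hgt : g t = (Complex.exp (Complex.I * μ * t) * Complex.exp (-(Complex.I * m * t))) * ((Real.exp (-(V * t^2/2)) : ℝ) : ℂ) := by
      simp only [hg]
      rw [Complex.ofReal_exp, ← Complex.exp_add, ← Complex.exp_add, ← Complex.exp_add]
      congr 1; push_cast; ring
    have nu : ‖Complex.exp (Complex.I * μ * t) * Complex.exp (-(Complex.I * m * t))‖ = 1 := by
      rw [← Complex.exp_add, show Complex.I * (μ:ℂ) * t + -(Complex.I * m * t) = ((μ * t - m * t : ℝ) : ℂ) * Complex.I by push_cast; ring]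
      exact Complex.norm_exp_ofReal_mul_I _
    by_cases ht : t ∈ Set.Ioc (-π) π
    · have habs : |t| ≤ π := abs_le.2 ⟨ht.1.le, ht.2⟩
      have hft : f t = chi P t * Complex.exp (-(Complex.I * m * t)) := by
        rw [hf, Set.indicator_of_mem ht]
      have := hP.tay t habs
      rw [hV', hM'] at this
      have e : f t - g t = (Complex.exp (Complex.I * μ * t) * Complex.exp (-(Complex.I * m * t))) * (chi P t * Complex.exp (-(Complex.I * ((μ : ℝ):ℂ) * t)) - ((Real.exp (-(V * t^2/2)) : ℝ) : ℂ)) := by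
        rw [hft, hgt]
        have : Complex.exp (Complex.I * μ * t) * Complex.exp (-(Complex.I * μ * t)) = 1 := by
          rw [← Complex.exp_add]; simp
        linear_combination (-(chi P t * Complex.exp (-(Complex.I * m * t)))) * this
      rw [e, norm_mul, nu, one_mul]
      refine this.trans (le_of_eq ?_)
      rw [show -(V/16) * t^2 = -(V * t^2/16) by ring]; ring
    · have hft : f t = 0 := by rw [hf, Set.indicator_of_notMem ht]
      have habs : 1 ≤ |t| := by
        by_contra hc
        push Not at hc
        have := abs_lt.1 hc
        exact ht ⟨by linarith [Real.pi_gt_three], by linarith [Real.pi_gt_three]⟩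
      rw [hft, zero_sub, norm_neg, hgt, norm_mul, nu, one_mul, Complex.norm_real, Real.norm_of_nonneg (Real.exp_pos _).le]
      have h1 : Real.exp (-(V * t^2/2)) ≤ Real.exp (-(V/16) * t^2) := by
        apply Real.exp_le_exp.2
        nlinarith [mul_nonneg hVp.le (sq_nonneg t)]
      have h2 : 1 ≤ |t|^3 := one_le_pow₀ habs
      have h3 : 1 ≤ 27 * V * |t|^3 := by nlinarith
      have := Real.exp_pos (-(V/16) * t^2)
      nlinarith
  obtain ⟨hi, hv⟩ := int_cube (V/16) (by positivity)
  have hfin := norm_integral_le_of_norm_le (hi.const_mul (27 * V)) (Filter.Eventually.of_forall hb)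
  rw [integral_const_mul, hv, integral_sub hfi hgi, hfint, hgint] at hfin
  set p := probX P m
  set q := (Real.sqrt (2 * π * V))⁻¹ * Real.exp (-((m : ℝ) - μ) ^ 2 / (2 * V))
  have e : (2 * π * (p:ℂ)) - ((2 * π * q : ℝ) : ℂ) = ((2 * π * (p - q) : ℝ) : ℂ) := by push_cast; ring
  rw [e, Complex.norm_real, Real.norm_eq_abs, abs_mul, abs_of_pos (by positivity : 0 < 2 * π)] at hfin
  have e2 : 27 * V * (1 / (V/16)^2) = 6912 / V := by field_simp; norm_num
  rw [e2] at hfin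
  have h3 := Real.pi_gt_three
  have : 6 * |p - q| ≤ 6912 / V := le_trans (by nlinarith [abs_nonneg (p-q)]) hfin
  have : 6 * (1800 / V) = 10800 / V := by ring
  have : 6912 / V ≤ 10800 / V := by gcongr; norm_num
  linarith

/-- LCLT in the log-concave case: if every root `ζ` of `P` satisfies
`|arg ζ| ∈ (2π/3, π]` and `Var(X) > 144×10⁷` then a local central limit theorem
holds with error `180/Var(X)^{3/4}`. -/
theorem lclt_log_concave_case (N : ℕ) (P : Polynomial ℝ)
    (hcoeff : ∀ m, 0 ≤ P.coeff m)
    (hdeg : P.degree = N)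
    (hp0 : 0 < P.coeff 0)
    (hroots : ∀ ζ : ℂ, Polynomial.aeval ζ P = 0 →
      2 * π / 3 < |Complex.arg ζ| ∧ |Complex.arg ζ| ≤ π)
    (hvar : 144 * 10 ^ 7 < VarX P) :
    ∀ m : ℤ,
      |probX P m -
          (Real.sqrt (2 * π * VarX P))⁻¹ *
            Real.exp (-((m : ℝ) - EX P) ^ 2 / (2 * VarX P))| ≤
        180 / (VarX P) ^ ((3 : ℝ) / 4) := by
  
  intro m
  have hP0 : P ≠ 0 := by
    rintro rfl
    simp at hp0
  have hl : 0 < P.leadingCoeff :=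
    lt_of_le_of_ne (hcoeff _) (Ne.symm (Polynomial.leadingCoeff_ne_zero.2 hP0))
  have hg : Good P := good_all _ P rfl hl (fun ζ hζ => (hroots ζ hζ).1)
  refine (good_final P hg (by linarith) m).trans ?_
  set V := VarX P
  have hV : 0 < V := by linarith
  have h1 : (10:ℝ) ≤ V ^ ((1:ℝ)/4) := by
    have : (10:ℝ) = ((10:ℝ)^(4:ℕ)) ^ ((1:ℝ)/4) := by
      rw [← Real.rpow_natCast, ← Real.rpow_mul (by norm_num)]; norm_num
    rw [this]
    apply Real.rpow_le_rpow (by norm_num) (by linarith) (by norm_num)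
  have h2 : V = V ^ ((3:ℝ)/4) * V ^ ((1:ℝ)/4) := by
    rw [← Real.rpow_add hV]; norm_num
  have h3 : 0 < V ^ ((3:ℝ)/4) := Real.rpow_pos_of_pos hV _
  rw [div_le_div_iff₀ hV h3]
  nlinarith
end

section
/- Let G be a finite graph (multiple edges allowed) with vertex set V and edge set E, every vertex of positive degree, and let C(v) be finite nonempty subsets of ℕ with at least one admissible subgraph. Suppose there is an angle φ ∈ [0, π/2] such that for every vertex v, every nonzero complex root ζ of p_v satisfies |arg(ζ)| ∈ [π − φ, π]. Then every nonzero complex root ξ of P_{(C)} satisfies |arg(ξ)| ∈ [π − 2φ, π]. -/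
open Finset Real

/-- The number of edges of the subgraph `M` incident to the vertex `v`
(the degree `d_M(v)`); for `M = univ` this is the degree `d_v` of `v` in `G`. -/
def degIn {V E : Type*} [Fintype E] [DecidableEq V]
    (v1 v2 : E → V) (M : Finset E) (v : V) : ℕ :=
  (M.filter (fun e => v1 e = v ∨ v2 e = v)).card

/-- The vertex polynomial `p_{C,d}(z) = Σ_{k ∈ C} C(d,k) z^k`, as a function of `z : ℂ`. -/
noncomputable def vPoly (C : Finset ℕ) (d : ℕ) (z : ℂ) : ℂ :=
  ∑ k ∈ C, (d.choose k : ℂ) * z ^ k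

/-- The graph-counting polynomial `P_{(C)}(z) = Σ_{M admissible} z^{|M|}`,
as a function of `z : ℂ`. -/
noncomputable def gcPoly {V E : Type*} [Fintype V] [Fintype E] [DecidableEq V] [DecidableEq E]
    (v1 v2 : E → V) (C : V → Finset ℕ) (z : ℂ) : ℂ :=
  ∑ M ∈ Finset.univ.filter (fun M : Finset E => ∀ v, degIn v1 v2 M v ∈ C v), z ^ M.card

/-- Cauchy-Schwarz / convexity of a disc tangent to the imaginary axis at `0`. -/
lemma multiset_disc (a : ℝ) (ha : 0 < a) (s : Multiset ℂ) (hs : ∀ u ∈ s, a * Complex.normSq u ≤ u.re) :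
    a * Complex.normSq s.sum ≤ s.card * s.sum.re := by
  induction s using Multiset.induction_on with
  | empty => simp
  | cons u s ih =>
    have h1 := ih (fun x hx => hs x (Multiset.mem_cons_of_mem hx))
    have h2 := hs u (Multiset.mem_cons_self u s)
    rcases Nat.eq_zero_or_pos s.card with h0 | h0
    · rw [Multiset.card_eq_zero] at h0
      subst h0
      simpa using h2
    · rw [Multiset.sum_cons, Multiset.card_cons]
      generalize s.sum = S at *
      have hn : (0 : ℝ) < s.card := by exact_mod_cast h0
      push_cast
      generalize (s.card : ℝ) = n at *
      simp only [Complex.normSq_apply, Complex.add_re, Complex.add_im] at *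
      have h3 : 0 ≤ a * ((S.re - n * u.re) ^ 2 + (S.im - n * u.im) ^ 2) := by positivity
      have h4 : n * (a * ((S.re + u.re) * (S.re + u.re) + (S.im + u.im) * (S.im + u.im)))
          ≤ n * ((n + 1) * (S.re + u.re)) := by
        have h5 := mul_le_mul_of_nonneg_left h1 (by positivity : 0 ≤ n + 1)
        have h6 := mul_le_mul_of_nonneg_left h2 (by positivity : 0 ≤ n * (n + 1))
        nlinarith
      rw [add_comm u.re, add_comm u.im]
      exact le_of_mul_le_mul_left h4 hn

/-- Laguerre's theorem for a half-plane. -/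
lemma laguerre_half (η : ℝ) (d : ℕ) (hd : 0 < d) (p : Polynomial ℂ) (hp : p.natDegree ≤ d)
    (h : ∀ z : ℂ, -η < z.re → p.eval z ≠ 0) (z z1 : ℂ) (hz : -η < z.re) (hz1 : -η < z1.re) :
    (d : ℂ) * p.eval z + (z1 - z) * p.derivative.eval z ≠ 0 := by
  intro hcon
  have hpz := h z hz
  have hsplit : p.Splits := IsAlgClosed.splits p
  rw [hsplit.eval_derivative_eq_eval_mul_sum hpz] at hcon
  set s : Multiset ℂ := p.roots.map (fun r => 1 / (z - r)) with hs
  have hcon2 : (d : ℂ) + (z1 - z) * s.sum = 0 := by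
    have : p.eval z * ((d : ℂ) + (z1 - z) * s.sum) = 0 := by linear_combination hcon
    exact (mul_eq_zero.mp this).resolve_left hpz
  have ha : 0 < z.re + η := by linarith
  have hdisc := multiset_disc (z.re + η) ha s (by
    intro u hu
    rw [hs, Multiset.mem_map] at hu
    obtain ⟨r, hr, rfl⟩ := hu
    have hr0 : p.eval r = 0 := (Polynomial.mem_roots'.mp hr).2
    have hrre : r.re ≤ -η := by
      by_contra hlt
      exact h r (not_le.mp hlt) hr0
    have hne : z - r ≠ 0 := by
      intro h0
      rw [sub_eq_zero] at h0
      rw [h0] at hpz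
      exact hpz hr0
    have hns : 0 < Complex.normSq (z - r) := Complex.normSq_pos.mpr hne
    rw [one_div, Complex.normSq_inv, Complex.inv_re, ← div_eq_mul_inv]
    gcongr
    simp only [Complex.sub_re]
    linarith)
  have hcard : (s.card : ℝ) ≤ d := by
    rw [hs, Multiset.card_map]
    exact_mod_cast (p.card_roots'.trans hp)
  generalize s.sum = S at *
  have hdpos : (0 : ℝ) < d := by exact_mod_cast hd
  have hS : S ≠ 0 := by
    rintro rfl
    simp at hcon2
    omega
  have hns : 0 < Complex.normSq S := Complex.normSq_pos.mpr hS
  have hSre : 0 < S.re := by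
    have h1 : 0 < (s.card : ℝ) * S.re := lt_of_lt_of_le (by positivity) hdisc
    by_contra hneg
    have := mul_nonpos_of_nonneg_of_nonpos (Nat.cast_nonneg (α := ℝ) s.card) (not_lt.mp hneg)
    linarith
  have hdisc2 : (z.re + η) * Complex.normSq S ≤ d * S.re :=
    hdisc.trans (mul_le_mul_of_nonneg_right hcard hSre.le)
  have hz1eq : z1 - z = - (d : ℂ) * S⁻¹ := by
    field_simp
    linear_combination hcon2
  have hre : z1.re - z.re = - (d * S.re / Complex.normSq S) := by
    have := congrArg Complex.re hz1eq
    rw [Complex.sub_re] at this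
    rw [this]
    simp [Complex.mul_re, Complex.inv_re]
    ring
  have : z.re + η ≤ d * S.re / Complex.normSq S := by
    rw [le_div_iff₀ hns]; exact hdisc2
  linarith

/-- Laguerre's theorem at the level of coefficients. -/
lemma laguerre_coeff (η : ℝ) (n : ℕ) (c : ℕ → ℂ)
    (h : ∀ z : ℂ, -η < z.re → ∑ k ∈ range (n + 2), ((n + 1).choose k : ℂ) * (c k * z ^ k) ≠ 0)
    (z1 : ℂ) (hz1 : -η < z1.re) (z : ℂ) (hz : -η < z.re) :
    ∑ k ∈ range (n + 1), (n.choose k : ℂ) * ((c k + z1 * c (k + 1)) * z ^ k) ≠ 0 := by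
  set p : Polynomial ℂ := ∑ k ∈ range (n + 2), Polynomial.C (((n + 1).choose k : ℂ) * c k) *
    Polynomial.X ^ k with hp
  have heval : ∀ z : ℂ, p.eval z = ∑ k ∈ range (n + 2), ((n + 1).choose k : ℂ) * (c k * z ^ k) := by
    intro z
    simp [hp, Polynomial.eval_finsetSum, mul_assoc]
  have heval2 : p.eval z = ∑ k ∈ range (n + 1), (n.choose k : ℂ) * (c k * z ^ k) +
      ∑ k ∈ range (n + 1), (n.choose k : ℂ) * (c (k + 1) * z ^ (k + 1)) := by
    rw [heval, Finset.sum_choose_succ_mul (fun k _ => c k * z ^ k) n]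
  have hder : p.derivative.eval z =
      ((n : ℂ) + 1) * ∑ k ∈ range (n + 1), (n.choose k : ℂ) * (c (k + 1) * z ^ k) := by
    rw [hp, Polynomial.derivative_sum, Polynomial.eval_finsetSum, Finset.sum_range_succ', mul_sum]
    simp only [Polynomial.derivative_C_mul_X_pow, Polynomial.eval_mul, Polynomial.eval_C,
      Polynomial.eval_pow, Polynomial.eval_X]
    simp only [Nat.cast_zero, mul_zero, zero_mul, add_zero, Nat.add_sub_cancel]
    refine Finset.sum_congr rfl fun k _ => ?_
    have := Nat.add_one_mul_choose_eq n k
    have h2 : ((n : ℂ) + 1) * (n.choose k) = ((n + 1).choose (k + 1)) * ((k : ℂ) + 1) := by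
      exact_mod_cast this
    push_cast
    linear_combination (-(c (k + 1)) * z ^ k) * h2
  have hdeg : p.natDegree ≤ n + 1 := by
    rw [hp]
    refine Polynomial.natDegree_sum_le_of_forall_le _ _ fun k hk => ?_
    refine (Polynomial.natDegree_C_mul_X_pow_le _ _).trans ?_
    have := Finset.mem_range.mp hk
    omega
  have hL := laguerre_half η (n + 1) (Nat.succ_pos n) p hdeg
    (fun z hz => by rw [heval]; exact h z hz) z z1 hz hz1
  intro h0
  apply hL
  have e1 : ∑ k ∈ range (n + 1), (n.choose k : ℂ) * (c (k + 1) * z ^ (k + 1)) =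
      z * ∑ k ∈ range (n + 1), (n.choose k : ℂ) * (c (k + 1) * z ^ k) := by
    rw [mul_sum]
    exact Finset.sum_congr rfl fun k _ => by ring
  have e2 : ∑ k ∈ range (n + 1), (n.choose k : ℂ) * ((c k + z1 * c (k + 1)) * z ^ k) =
      ∑ k ∈ range (n + 1), (n.choose k : ℂ) * (c k * z ^ k) +
      z1 * ∑ k ∈ range (n + 1), (n.choose k : ℂ) * (c (k + 1) * z ^ k) := by
    rw [mul_sum, ← Finset.sum_add_distrib]
    exact Finset.sum_congr rfl fun k _ => by ring
  rw [heval2, hder, e1]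
  rw [e2] at h0
  push_cast
  linear_combination ((n : ℂ) + 1) * h0

/-- Grace-Walsh-Szego, for a product of symmetric multi-affine polynomials. -/
lemma gws_prod {V ι : Type*} [Fintype V] [DecidableEq V] [DecidableEq ι] (η : ℝ) (h : ι → V)
    (z : ι → ℂ) (hz : ∀ i, -η < (z i).re) (I : Finset ι) :
    ∀ c : V → ℕ → ℂ, (∀ v, ∀ w : ℂ, -η < w.re →
      ∑ k ∈ range ((I.filter (fun i => h i = v)).card + 1),
        ((I.filter (fun i => h i = v)).card.choose k : ℂ) * (c v k * w ^ k) ≠ 0) →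
    ∑ A ∈ I.powerset, (∏ v, c v (A.filter (fun i => h i = v)).card) * ∏ i ∈ A, z i ≠ 0 := by
  induction I using Finset.induction_on with
  | empty =>
    intro c hc
    by_cases hw : ∃ w : ℂ, -η < w.re
    · obtain ⟨w, hw⟩ := hw
      simp only [Finset.powerset_empty, Finset.sum_singleton, Finset.filter_empty,
        Finset.card_empty, Finset.prod_empty, mul_one]
      rw [Finset.prod_ne_zero_iff]
      intro v _
      have := hc v w hw
      simpa using this
    · exact absurd ⟨((-η + 1 : ℝ) : ℂ), by rw [Complex.ofReal_re]; linarith⟩ hw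
  | insert i I hi ih =>
    intro c hc
    rw [Finset.sum_powerset_insert hi, ← Finset.sum_add_distrib]
    have key := ih (fun v k => if v = h i then c v k + z i * c v (k + 1) else c v k) ?_
    · convert key using 1
      refine Finset.sum_congr rfl fun A hA => ?_
      have hiA : i ∉ A := fun hh => hi (Finset.mem_powerset.mp hA hh)
      rw [Finset.prod_insert hiA]
      rw [← Finset.mul_prod_erase univ _ (Finset.mem_univ (h i)),
        ← Finset.mul_prod_erase univ _ (Finset.mem_univ (h i)),
        ← Finset.mul_prod_erase univ _ (Finset.mem_univ (h i))]
      have e1 : ∏ x ∈ univ.erase (h i), c x ((insert i A).filter (fun j => h j = x)).card =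
          ∏ x ∈ univ.erase (h i), c x (A.filter (fun j => h j = x)).card := by
        refine Finset.prod_congr rfl fun v hv => ?_
        rw [Finset.filter_insert, if_neg (Finset.ne_of_mem_erase hv).symm]
      have e2 : ∏ x ∈ univ.erase (h i), (if x = h i then
            c x (A.filter (fun j => h j = x)).card + z i * c x ((A.filter (fun j => h j = x)).card + 1)
            else c x (A.filter (fun j => h j = x)).card) =
          ∏ x ∈ univ.erase (h i), c x (A.filter (fun j => h j = x)).card := by
        refine Finset.prod_congr rfl fun v hv => ?_
        rw [if_neg (Finset.ne_of_mem_erase hv)]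
      rw [e1, e2, if_pos rfl, Finset.filter_insert, if_pos rfl,
        Finset.card_insert_of_notMem (by simp [hiA])]
      ring
    · intro v w hw
      have hcv := hc v
      by_cases hv : v = h i
      · subst hv
        rw [Finset.filter_insert, if_pos rfl, Finset.card_insert_of_notMem (by simp [hi])] at hcv
        simp only [if_true]
        exact laguerre_coeff η _ (c (h i)) hcv (z i) (hz i) w hw
      · rw [Finset.filter_insert, if_neg (Ne.symm hv)] at hcv
        simp only [if_neg hv]
        exact hcv w hw

/-- The elementary Asano contraction. -/
lemma asano_one (η : ℝ) (hη : 0 < η) (a b c d : ℂ)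
    (h : ∀ x y : ℂ, -η < x.re → -η < y.re → a + b * x + c * y + d * (x * y) ≠ 0) : a + d ≠ 0 := by
  intro had
  have ha : a ≠ 0 := by
    have := h 0 0 (by simpa using hη) (by simpa using hη)
    simpa using this
  have hd : d ≠ 0 := by
    rintro rfl
    exact ha (by simpa using had)
  -- a root of the quadratic
  obtain ⟨r, hr⟩ : ∃ r : ℂ, a + (b + c) * r + d * (r * r) = 0 := by
    obtain ⟨s, hs⟩ := IsAlgClosed.exists_pow_nat_eq ((b + c) ^ 2 - 4 * a * d) (n := 2) (by norm_num)
    refine ⟨(-(b + c) + s) / (2 * d), ?_⟩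
    field_simp
    linear_combination hs
  have hr0 : r ≠ 0 := by
    rintro rfl
    exact ha (by simpa using hr)
  have hrre : r.re ≤ -η := by
    by_contra hlt
    apply h r r (not_le.mp hlt) (not_le.mp hlt)
    linear_combination hr
  -- the other root is `-1/r`
  have hroot2 : a + b * (-r⁻¹) + c * (-r⁻¹) + d * ((-r⁻¹) * (-r⁻¹)) = 0 := by
    field_simp
    linear_combination (-1 : ℂ) * hr + (1 + r ^ 2) * had
  apply h (-r⁻¹) (-r⁻¹) _ _ hroot2 <;>
  · have hns : 0 < Complex.normSq r := Complex.normSq_pos.mpr hr0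
    rw [Complex.neg_re, Complex.inv_re]
    have : r.re / Complex.normSq r < 0 := div_neg_of_neg_of_pos (by linarith) hns
    linarith

/-- Iterated Asano contraction. -/
lemma asano_all {E : Type*} [DecidableEq E] (η : ℝ) (hη : 0 < η) (S : Finset E) :
    ∀ W : Finset E → Finset E → ℂ,
    (∀ x y : E → ℂ, (∀ e, -η < (x e).re) → (∀ e, -η < (y e).re) →
      ∑ A ∈ S.powerset, ∑ B ∈ S.powerset, W A B * ((∏ e ∈ A, x e) * ∏ e ∈ B, y e) ≠ 0) →
    ∑ A ∈ S.powerset, W A A ≠ 0 := by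
  induction S using Finset.induction_on with
  | empty =>
    intro W h
    have := h 0 0 (fun _ => by simpa using hη) (fun _ => by simpa using hη)
    simpa using this
  | insert e S he ih =>
    intro W h
    rw [Finset.sum_powerset_insert he, ← Finset.sum_add_distrib]
    apply ih (fun A B => W A B + W (insert e A) (insert e B))
    intro x y hx hy
    simp only [add_mul, Finset.sum_add_distrib]
    apply asano_one η hη _
      (∑ A ∈ S.powerset, ∑ B ∈ S.powerset, W (insert e A) B * ((∏ e ∈ A, x e) * ∏ e ∈ B, y e))
      (∑ A ∈ S.powerset, ∑ B ∈ S.powerset, W A (insert e B) * ((∏ e ∈ A, x e) * ∏ e ∈ B, y e))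
    intro s t hs ht
    have hst := h (Function.update x e s) (Function.update y e t)
      (fun e' => by
        by_cases hh : e' = e
        · subst hh; simpa using hs
        · simpa [hh] using hx e')
      (fun e' => by
        by_cases hh : e' = e
        · subst hh; simpa using ht
        · simpa [hh] using hy e')
    convert hst using 1
    have hupd : ∀ (f : E → ℂ) (u : ℂ), ∀ A ∈ S.powerset,
        ∏ e' ∈ A, Function.update f e u e' = ∏ e' ∈ A, f e' := by
      intro f u A hA
      refine Finset.prod_congr rfl fun e' he' => ?_
      rw [Function.update_of_ne]
      rintro rfl
      exact he (Finset.mem_powerset.mp hA he')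
    have hupd2 : ∀ (f : E → ℂ) (u : ℂ), ∀ A ∈ S.powerset,
        ∏ e' ∈ insert e A, Function.update f e u e' = u * ∏ e' ∈ A, f e' := by
      intro f u A hA
      rw [Finset.prod_insert (fun hh => he (Finset.mem_powerset.mp hA hh)), hupd f u A hA,
        Function.update_self]
    rw [Finset.sum_powerset_insert he]
    simp only [Finset.sum_powerset_insert he, Finset.sum_add_distrib, Finset.sum_mul]
    have r1 : ∑ A ∈ S.powerset, ∑ B ∈ S.powerset, W A B *
          ((∏ e' ∈ A, Function.update x e s e') * ∏ e' ∈ B, Function.update y e t e') =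
        ∑ A ∈ S.powerset, ∑ B ∈ S.powerset, W A B * ((∏ e ∈ A, x e) * ∏ e ∈ B, y e) :=
      Finset.sum_congr rfl fun A hA => Finset.sum_congr rfl fun B hB => by
        rw [hupd x s A hA, hupd y t B hB]
    have r2 : ∑ A ∈ S.powerset, ∑ B ∈ S.powerset, W (insert e A) B *
          ((∏ e' ∈ insert e A, Function.update x e s e') * ∏ e' ∈ B, Function.update y e t e') =
        ∑ A ∈ S.powerset, ∑ B ∈ S.powerset,
          W (insert e A) B * ((∏ e ∈ A, x e) * ∏ e ∈ B, y e) * s :=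
      Finset.sum_congr rfl fun A hA => Finset.sum_congr rfl fun B hB => by
        rw [hupd2 x s A hA, hupd y t B hB]; ring
    have r3 : ∑ A ∈ S.powerset, ∑ B ∈ S.powerset, W A (insert e B) *
          ((∏ e' ∈ A, Function.update x e s e') * ∏ e' ∈ insert e B, Function.update y e t e') =
        ∑ A ∈ S.powerset, ∑ B ∈ S.powerset,
          W A (insert e B) * ((∏ e ∈ A, x e) * ∏ e ∈ B, y e) * t :=
      Finset.sum_congr rfl fun A hA => Finset.sum_congr rfl fun B hB => by
        rw [hupd x s A hA, hupd2 y t B hB]; ring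
    have r4 : ∑ A ∈ S.powerset, ∑ B ∈ S.powerset, W (insert e A) (insert e B) *
          ((∏ e' ∈ insert e A, Function.update x e s e') *
            ∏ e' ∈ insert e B, Function.update y e t e') =
        ∑ A ∈ S.powerset, ∑ B ∈ S.powerset,
          W (insert e A) (insert e B) * ((∏ e ∈ A, x e) * ∏ e ∈ B, y e) * (s * t) :=
      Finset.sum_congr rfl fun A hA => Finset.sum_congr rfl fun B hB => by
        rw [hupd2 x s A hA, hupd2 y t B hB]; ring
    rw [r1, r2, r3, r4]
    simp only [← Finset.sum_mul]
    ring

lemma card_filter_disjSum {V E : Type*} [DecidableEq V] (v1 v2 : E → V) (A B : Finset E) (v : V) :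
    ((A.disjSum B).filter (fun i => Sum.elim v1 v2 i = v)).card =
      (A.filter (fun e => v1 e = v)).card + (B.filter (fun e => v2 e = v)).card := by
  have : (A.disjSum B).filter (fun i => Sum.elim v1 v2 i = v) =
      (A.filter (fun e => v1 e = v)).disjSum (B.filter (fun e => v2 e = v)) := by
    ext (x | x) <;> simp
  rw [this, Finset.card_disjSum]

lemma degIn_eq {V E : Type*} [Fintype E] [DecidableEq V] [DecidableEq E] (v1 v2 : E → V)
    (hne : ∀ e, v1 e ≠ v2 e) (M : Finset E) (v : V) :
    (M.filter (fun e => v1 e = v)).card + (M.filter (fun e => v2 e = v)).card =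
      degIn v1 v2 M v := by
  unfold degIn
  rw [Finset.filter_or, Finset.card_union_of_disjoint]
  rw [Finset.disjoint_left]
  intro e h1 h2
  exact hne e ((Finset.mem_filter.mp h1).2.trans (Finset.mem_filter.mp h2).2.symm)

/-- Nonvanishing of the graph sum with general vertex weights. -/
lemma graph_nonvanish {V E : Type*} [Fintype V] [Fintype E] [DecidableEq V] [DecidableEq E]
    (v1 v2 : E → V) (hne : ∀ e, v1 e ≠ v2 e) (η : ℝ) (hη : 0 < η) (c : V → ℕ → ℂ)
    (hc : ∀ v, ∀ w : ℂ, -η < w.re → ∑ k ∈ range (degIn v1 v2 univ v + 1),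
      ((degIn v1 v2 univ v).choose k : ℂ) * (c v k * w ^ k) ≠ 0) :
    ∑ M : Finset E, ∏ v, c v (degIn v1 v2 M v) ≠ 0 := by
  have := asano_all η hη (univ : Finset E) (fun A B => ∏ v, c v
    ((A.filter (fun e => v1 e = v)).card + (B.filter (fun e => v2 e = v)).card)) ?_
  · simpa only [Finset.powerset_univ, degIn_eq v1 v2 hne] using this
  intro x y hx hy
  have hg := gws_prod η (Sum.elim v1 v2) (Sum.elim x y) (by rintro (e | e); exacts [hx e, hy e])
    ((univ : Finset E).disjSum univ) c (by
      intro v w hw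
      rw [card_filter_disjSum, degIn_eq v1 v2 hne]
      exact hc v w hw)
  rw [Finset.univ_disjSum_univ, Finset.powerset_univ] at hg
  rw [Finset.powerset_univ, ← Fintype.sum_prod_type']
  rw [← Finset.sumEquiv.symm.toEquiv.sum_comp] at hg
  convert hg using 1
  refine Finset.sum_congr rfl fun AB _ => ?_
  simp [card_filter_disjSum]

/-- Shifted and rescaled vertex weights. -/
noncomputable def shiftW (C : Finset ℕ) (d : ℕ) (ε w : ℂ) (k : ℕ) : ℂ :=
  ∑ i ∈ range (d - k + 1), ((d - k).choose i : ℂ) * (ε ^ i * (w ^ (k + i) * if k + i ∈ C then 1 else 0))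

lemma vPoly_eq (C : Finset ℕ) (d : ℕ) (z : ℂ) :
    vPoly C d z = ∑ k ∈ range (d + 1), (d.choose k : ℂ) * (z ^ k * if k ∈ C then 1 else 0) := by
  unfold vPoly
  simp only [mul_ite, mul_one, mul_zero]
  rw [← Finset.sum_filter]
  symm
  rw [← Finset.sum_filter_of_ne (s := C) (p := fun k => k ∈ range (d + 1))]
  · refine Finset.sum_congr ?_ fun _ _ => rfl
    ext k; simp [and_comm]
  · intro k _ hk
    rw [Finset.mem_range]
    by_contra hlt
    apply hk
    rw [Nat.choose_eq_zero_of_lt (by omega)]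
    simp

lemma shiftW_sum (C : Finset ℕ) (d : ℕ) (ε w z : ℂ) :
    ∑ k ∈ range (d + 1), (d.choose k : ℂ) * (shiftW C d ε w k * z ^ k) =
      vPoly C d (w * (z + ε)) := by
  rw [vPoly_eq]
  have hR : ∀ j ∈ range (d + 1),
      (d.choose j : ℂ) * ((w * (z + ε)) ^ j * if j ∈ C then 1 else 0) =
      ∑ k ∈ range (j + 1), (d.choose j : ℂ) * (z ^ k * ε ^ (j - k) * (j.choose k : ℂ) *
        (w ^ j * if j ∈ C then 1 else 0)) := by
    intro j _
    rw [mul_pow, add_pow, ← Finset.mul_sum, ← Finset.sum_mul]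
    ring
  rw [Finset.sum_congr rfl hR, Finset.sum_sigma', Finset.sum_congr rfl (fun k _ => by
    rw [shiftW, Finset.sum_mul, Finset.mul_sum]), Finset.sum_sigma']
  refine Finset.sum_bij' (fun p _ => (⟨p.1 + p.2, p.1⟩ : (_ : ℕ) × ℕ))
    (fun p _ => (⟨p.2, p.1 - p.2⟩ : (_ : ℕ) × ℕ)) ?_ ?_ ?_ ?_ ?_
  · rintro ⟨k, i⟩ h
    simp only [Finset.mem_sigma, Finset.mem_range] at h ⊢
    omega
  · rintro ⟨k, i⟩ h
    simp only [Finset.mem_sigma, Finset.mem_range] at h ⊢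
    omega
  · rintro ⟨k, i⟩ h
    simp
  · rintro ⟨k, i⟩ h
    simp only [Finset.mem_sigma, Finset.mem_range] at h
    have : i + (k - i) = k := by omega
    simp [this]
  · rintro ⟨k, i⟩ h
    have h1 := Nat.choose_mul (n := d) (k := k + i) (s := k) (by omega)
    rw [Nat.add_sub_cancel_left] at h1
    have h2 : (d.choose (k + i) : ℂ) * ((k + i).choose k) = d.choose k * (d - k).choose i := by
      exact_mod_cast h1
    simp only [Nat.add_sub_cancel_left]
    linear_combination (-(z ^ k * ε ^ i * (w ^ (k + i) * if k + i ∈ C then 1 else 0))) * h2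

lemma shiftW_zero (C : Finset ℕ) (d : ℕ) (w : ℂ) (k : ℕ) :
    shiftW C d 0 w k = if k ∈ C then w ^ k else 0 := by
  unfold shiftW
  rw [Finset.sum_eq_single_of_mem 0 (by simp)]
  · simp
  · intro i _ hi
    simp [hi]

lemma sum_degIn {V E : Type*} [Fintype V] [Fintype E] [DecidableEq V] [DecidableEq E]
    (v1 v2 : E → V) (hne : ∀ e, v1 e ≠ v2 e) (M : Finset E) :
    ∑ v, degIn v1 v2 M v = 2 * M.card := by
  simp only [← degIn_eq v1 v2 hne, Finset.sum_add_distrib]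
  rw [← Finset.card_eq_sum_card_fiberwise (fun _ _ => Finset.mem_coe.mpr (Finset.mem_univ _)),
    ← Finset.card_eq_sum_card_fiberwise (fun _ _ => Finset.mem_coe.mpr (Finset.mem_univ _))]
  ring

lemma sum_shiftW_zero {V E : Type*} [Fintype V] [Fintype E] [DecidableEq V] [DecidableEq E]
    (v1 v2 : E → V) (hne : ∀ e, v1 e ≠ v2 e) (C : V → Finset ℕ) (D : V → ℕ) (w : ℂ) :
    ∑ M : Finset E, ∏ v, shiftW (C v) (D v) 0 w (degIn v1 v2 M v) = gcPoly v1 v2 C (w ^ 2) := by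
  unfold gcPoly
  rw [Finset.sum_filter]
  refine Finset.sum_congr rfl fun M _ => ?_
  simp only [shiftW_zero]
  split_ifs with h
  · rw [Finset.prod_congr rfl (fun v _ => if_pos (h v)), Finset.prod_pow_eq_pow_sum,
      sum_degIn v1 v2 hne, pow_mul]
  · push Not at h
    obtain ⟨v, hv⟩ := h
    exact Finset.prod_eq_zero (Finset.mem_univ v) (if_neg hv)

/-- A Hurwitz-type statement. -/
lemma hurwitz_basic (F : ℂ → ℂ → ℂ) (hcont : Continuous (fun p : ℂ × ℂ => F p.1 p.2))
    (hdiff : ∀ ε, Differentiable ℂ (F ε)) (U : Set ℂ) (hU : IsOpen U)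
    (hF : ∀ ε : ℝ, 0 < ε → ∀ w ∈ U, F ε w ≠ 0) (w0 : ℂ) (hw0 : w0 ∈ U)
    (hiso : ∀ᶠ w in nhdsWithin w0 {w0}ᶜ, F 0 w ≠ 0) : F 0 w0 ≠ 0 := by
  intro hzero
  obtain ⟨r1, hr1, hball⟩ := Metric.isOpen_iff.mp hU w0 hw0
  rw [eventually_nhdsWithin_iff, Metric.eventually_nhds_iff] at hiso
  obtain ⟨r2, hr2, hiso⟩ := hiso
  set r := min r1 r2 / 2 with hr
  have hmin : 0 < min r1 r2 := lt_min hr1 hr2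
  have hrpos : 0 < r := by positivity
  have hrr1 : r < r1 := by have := min_le_left r1 r2; linarith
  have hrr2 : r < r2 := by have := min_le_right r1 r2; linarith
  have hcs : IsCompact (Metric.sphere w0 r) := isCompact_sphere w0 r
  have hne : (Metric.sphere w0 r).Nonempty := NormedSpace.sphere_nonempty.mpr hrpos.le
  have hc0 : ∀ ε : ℂ, Continuous (F ε) := fun ε => (hdiff ε).continuous
  obtain ⟨wm, hwm, hmin'⟩ := hcs.exists_isMinOn hne (hc0 0).norm.continuousOn
  have hm : 0 < ‖F 0 wm‖ := by
    rw [norm_pos_iff]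
    rw [Metric.mem_sphere] at hwm
    apply hiso (by rw [hwm]; exact hrr2)
    intro h
    rw [Set.mem_singleton_iff] at h
    rw [h, dist_self] at hwm
    exact hrpos.ne hwm
  set m := ‖F 0 wm‖ with hmdef
  -- uniform closeness on the sphere
  have hunif : ∀ᶠ ε : ℂ in nhds 0, ∀ w ∈ Metric.sphere w0 r, m / 2 < ‖F ε w‖ := by
    apply hcs.eventually_forall_of_forall_eventually
    intro w hw
    have hlt : m / 2 < ‖F 0 w‖ := lt_of_lt_of_le (by linarith) (hmin' hw)
    have hcc : Continuous (fun p : ℂ × ℂ => ‖F p.1 p.2‖) := hcont.norm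
    exact hcc.continuousAt.eventually (lt_mem_nhds hlt)
  have hcen : ∀ᶠ ε : ℂ in nhds 0, ‖F ε w0‖ < m / 2 := by
    have hcc : Continuous (fun ε : ℂ => ‖F ε w0‖) :=
      (hcont.comp (by fun_prop : Continuous (fun ε : ℂ => (ε, w0)))).norm
    have hlt : ‖F 0 w0‖ < m / 2 := by
      rw [hzero, norm_zero]
      positivity
    exact hcc.continuousAt.eventually (gt_mem_nhds hlt)
  obtain ⟨δ, hδ, hboth⟩ := Metric.eventually_nhds_iff.mp (hunif.and hcen)
  obtain ⟨h1, h2⟩ := hboth (y := ((δ / 2 : ℝ) : ℂ)) (by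
    rw [dist_zero_right, Complex.norm_real, Real.norm_eq_abs, abs_of_pos (by positivity)]
    linarith)
  set ε : ℂ := ((δ / 2 : ℝ) : ℂ) with hε
  have hnz : ∀ w ∈ Metric.closedBall w0 r, F ε w ≠ 0 := fun w hw =>
    hF (δ / 2) (by positivity) w (hball (Metric.closedBall_subset_ball hrr1 hw))
  have hd : DiffContOnCl ℂ (fun w => (F ε w)⁻¹) (Metric.ball w0 r) := by
    apply DifferentiableOn.diffContOnCl
    rw [closure_ball w0 hrpos.ne']
    exact (hdiff ε).differentiableOn.inv hnz
  have hmax := Complex.norm_le_of_forall_mem_frontier_norm_le Metric.isBounded_ball hd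
    (C := (m / 2)⁻¹) (by
      intro w hw
      rw [frontier_ball w0 hrpos.ne'] at hw
      rw [norm_inv]
      exact inv_anti₀ (by positivity) (h1 w hw).le)
    (z := w0) (subset_closure (Metric.mem_ball_self hrpos))
  rw [norm_inv] at hmax
  have hpos : 0 < ‖F ε w0‖ := norm_pos_iff.mpr (hnz w0 (Metric.mem_closedBall_self hrpos.le))
  have := (inv_le_inv₀ hpos (by positivity)).mp hmax
  linarith

lemma sector_isOpen (α : ℝ) (hα : α ≤ π / 2) : IsOpen {w : ℂ | w ≠ 0 ∧ |Complex.arg w| < α} := by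
  rw [isOpen_iff_mem_nhds]
  rintro w ⟨hw, harg⟩
  have hre : 0 < w.re :=
    (Complex.abs_arg_lt_pi_div_two_iff.mp (lt_of_lt_of_le harg hα)).resolve_right hw
  have hs : w ∈ Complex.slitPlane := Or.inl hre
  have h1 : ∀ᶠ x in nhds w, |Complex.arg x| < α :=
    (Complex.continuousAt_arg hs).abs.eventually (gt_mem_nhds harg)
  have h2 : ∀ᶠ x in nhds w, x ≠ 0 := isOpen_ne.mem_nhds hw
  exact h2.and h1

/-- If every nonzero root `ζ` of every vertex polynomial `p_v` satisfies
`|arg ζ| ∈ [π − φ, π]`, then every nonzero root `ξ` of the graph-counting polynomial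
satisfies `|arg ξ| ∈ [π − 2φ, π]`. -/
theorem gcPoly_root_argument_wedge {V E : Type*} [Fintype V] [Fintype E]
    [DecidableEq V] [DecidableEq E]
    (v1 v2 : E → V) (hne : ∀ e, v1 e ≠ v2 e)
    (C : V → Finset ℕ) (hC : ∀ v, (C v).Nonempty)
    (hdeg : ∀ v, 0 < degIn v1 v2 Finset.univ v)
    (hadm : ∃ M : Finset E, ∀ v, degIn v1 v2 M v ∈ C v)
    (φ : ℝ) (hφ : φ ∈ Set.Icc 0 (π / 2))
    (hroots : ∀ v, ∀ ζ : ℂ, ζ ≠ 0 → vPoly (C v) (degIn v1 v2 Finset.univ v) ζ = 0 →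
      |Complex.arg ζ| ∈ Set.Icc (π - φ) π) :
    ∀ ξ : ℂ, ξ ≠ 0 → gcPoly v1 v2 C ξ = 0 →
      |Complex.arg ξ| ∈ Set.Icc (π - 2 * φ) π := by
  intro ξ hξ hroot
  refine ⟨?_, Complex.abs_arg_le_pi ξ⟩
  by_contra hlt
  rw [not_le] at hlt
  obtain ⟨hφ0, hφ1⟩ := hφ
  set D : V → ℕ := fun v => degIn v1 v2 univ v with hD
  set F : ℂ → ℂ → ℂ := fun ε w =>
    ∑ M : Finset E, ∏ v, shiftW (C v) (D v) ε w (degIn v1 v2 M v) with hF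
  have hF0 : ∀ w, F 0 w = gcPoly v1 v2 C (w ^ 2) := fun w =>
    sum_shiftW_zero v1 v2 hne C D w
  set U : Set ℂ := {w : ℂ | w ≠ 0 ∧ |Complex.arg w| < π / 2 - φ} with hUdef
  -- the square root of `ξ`
  set w0 : ℂ := Complex.exp (Complex.log ξ / 2) with hw0
  have hw0sq : w0 ^ 2 = ξ := by
    rw [hw0, ← Complex.exp_nat_mul]
    have : ((2 : ℕ) : ℂ) * (Complex.log ξ / 2) = Complex.log ξ := by push_cast; ring
    rw [this, Complex.exp_log hξ]
  have him : (Complex.log ξ / 2).im = Complex.arg ξ / 2 := by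
    rw [show (2 : ℂ) = ((2 : ℝ) : ℂ) by norm_num, Complex.div_ofReal_im, Complex.log_im]
  have hw0U : w0 ∈ U := by
    refine ⟨Complex.exp_ne_zero _, ?_⟩
    have hpi := Real.pi_pos
    have h1 := Complex.neg_pi_lt_arg ξ
    have h2 := Complex.arg_le_pi ξ
    have h3 : Complex.arg w0 = Complex.arg ξ / 2 := by
      rw [hw0, Complex.arg_exp, him, toIocMod_eq_self]
      constructor <;> linarith
    rw [h3, abs_div, abs_two]
    linarith
  refine hurwitz_basic F ?_ ?_ U (sector_isOpen _ (by linarith)) ?_ w0 hw0U ?_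
    (by rw [hF0, hw0sq]; exact hroot)
  · simp only [hF, shiftW]
    fun_prop
  · intro ε
    simp only [hF, shiftW]
    fun_prop
  · intro ε hε w hw
    apply graph_nonvanish v1 v2 hne ε hε (fun v k => shiftW (C v) (D v) ε w k)
    intro v z hz
    rw [shiftW_sum]
    intro hzero
    set u : ℂ := z + ε with hu
    have hure : 0 < u.re := by
      rw [hu, Complex.add_re, Complex.ofReal_re]; linarith
    have hu0 : u ≠ 0 := by
      intro h; rw [h] at hure; simp at hure
    have hua : |Complex.arg u| < π / 2 := Complex.abs_arg_lt_pi_div_two_iff.mpr (Or.inl hure)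
    have hr := (hroots v (w * u) (mul_ne_zero hw.1 hu0) hzero).1
    have hwa := hw.2
    have hsum := abs_add_le (Complex.arg w) (Complex.arg u)
    rw [Complex.arg_mul hw.1 hu0] at hr
    · linarith
    · have := abs_lt.mp hua
      have := abs_lt.mp hwa
      constructor <;> linarith
  · -- `F 0` is a nonzero polynomial
    set Q : Polynomial ℂ := ∑ M ∈ Finset.univ.filter
      (fun M : Finset E => ∀ v, degIn v1 v2 M v ∈ C v), Polynomial.X ^ (2 * M.card) with hQ
    have hQe : ∀ w, Q.eval w = F 0 w := by
      intro w
      rw [hF0, hQ, Polynomial.eval_finsetSum, gcPoly]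
      simp [pow_mul]
    have hQ0 : Q ≠ 0 := by
      intro h
      have h1 : Q.eval 1 = 0 := by rw [h]; simp
      rw [hQ, Polynomial.eval_finsetSum] at h1
      simp only [Polynomial.eval_pow, Polynomial.eval_X, one_pow, Finset.sum_const,
        nsmul_eq_mul, mul_one, Nat.cast_eq_zero, Finset.card_eq_zero] at h1
      obtain ⟨M, hM⟩ := hadm
      have : M ∈ Finset.univ.filter (fun M : Finset E => ∀ v, degIn v1 v2 M v ∈ C v) := by
        simpa using hM
      rw [h1] at this
      simp at this
    have hfin : (Q.rootSet ℂ).Finite := Q.rootSet_finite ℂ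
    have hopen : IsOpen ((Q.rootSet ℂ \ {w0})ᶜ) := (hfin.sdiff).isClosed.isOpen_compl
    rw [eventually_nhdsWithin_iff]
    filter_upwards [hopen.mem_nhds (by simp)] with w hw hww h0
    apply hw
    refine ⟨?_, hww⟩
    rw [Polynomial.mem_rootSet]
    refine ⟨hQ0, ?_⟩
    rw [Polynomial.coe_aeval_eq_eval, hQe, h0]
end
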